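/- Let 0 < ν₂ < ν₁ < ∞, set δ := ν₁ − ν₂, and for x, z > 0 define g(x, z) := φ((xδ + ν₁z)/(σ√(δz))) · (2ν₂√δ (x + 2z))/(σ³ z^{3/2}) + (4ν₂(2δ − ν₁)/σ⁴) · exp((−2δx − 2ν₂z)/σ²) · Φ((−xδ − (2ν₂ − ν₁)z)/(σ√(δz))). Then ∫₀^∞ ∫₀^∞ z · x · g(x, z) dx dz = σ⁴(ν₁² − ν₂²)/(4ν₁³ν₂). -/

import Mathlib

open MeasureTheory Filter Topology

noncomputable section

/-- The standard normal density `φ`. -/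
def stdNormalPDF (u : ℝ) : ℝ := Real.exp (-(u ^ 2) / 2) / Real.sqrt (2 * Real.pi)

/-- The standard normal cumulative distribution function `Φ`. -/
def stdNormalCDF (u : ℝ) : ℝ := ∫ v in Set.Iic u, stdNormalPDF v

lemma stdNormalPDF_eq_gaussianPDFReal :
    stdNormalPDF = ProbabilityTheory.gaussianPDFReal 0 1 := by
  funext u
  simp [stdNormalPDF, ProbabilityTheory.gaussianPDFReal]
  ring

lemma integrable_stdNormalPDF : Integrable stdNormalPDF := by
  rw [stdNormalPDF_eq_gaussianPDFReal]
  exact ProbabilityTheory.integrable_gaussianPDFReal 0 1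

lemma integral_stdNormalPDF : ∫ u, stdNormalPDF u = 1 := by
  rw [stdNormalPDF_eq_gaussianPDFReal]
  exact ProbabilityTheory.integral_gaussianPDFReal_eq_one 0 one_ne_zero

lemma stdNormalPDF_nonneg (u : ℝ) : 0 ≤ stdNormalPDF u := by
  unfold stdNormalPDF; positivity

lemma continuous_stdNormalPDF : Continuous stdNormalPDF := by
  unfold stdNormalPDF; fun_prop

lemma stdNormalPDF_neg (u : ℝ) : stdNormalPDF (-u) = stdNormalPDF u := by
  simp [stdNormalPDF]

lemma hasDerivAt_stdNormalPDF (u : ℝ) :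
    HasDerivAt stdNormalPDF (-u * stdNormalPDF u) u := by
  have h : HasDerivAt (fun u : ℝ => -(u ^ 2) / 2) (-u) u :=
    (((hasDerivAt_pow 2 u).fun_neg).div_const 2).congr_deriv (by norm_num; ring)
  refine (h.exp.div_const (Real.sqrt (2 * Real.pi))).congr_deriv ?_
  simp only [stdNormalPDF]; ring

lemma hasDerivAt_stdNormalCDF (u : ℝ) :
    HasDerivAt stdNormalCDF (stdNormalPDF u) u := by
  have h : stdNormalCDF = fun t => stdNormalCDF 0 + ∫ v in (0 : ℝ)..t, stdNormalPDF v := by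
    funext t
    rw [← intervalIntegral.integral_Iic_sub_Iic integrable_stdNormalPDF.integrableOn
      integrable_stdNormalPDF.integrableOn]
    simp [stdNormalCDF]
  rw [h]
  exact (intervalIntegral.integral_hasDerivAt_right
    (continuous_stdNormalPDF.intervalIntegrable _ _)
    continuous_stdNormalPDF.stronglyMeasurable.stronglyMeasurableAtFilter
    continuous_stdNormalPDF.continuousAt).const_add _

lemma stdNormalCDF_nonneg (u : ℝ) : 0 ≤ stdNormalCDF u :=
  integral_nonneg fun v => stdNormalPDF_nonneg v

lemma stdNormalCDF_le_one (u : ℝ) : stdNormalCDF u ≤ 1 := by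
  rw [← integral_stdNormalPDF]
  exact setIntegral_le_integral integrable_stdNormalPDF
    (Eventually.of_forall stdNormalPDF_nonneg)

lemma stdNormalCDF_zero : stdNormalCDF 0 = 1 / 2 := by
  have h1 : ∫ v in Set.Ioi (0 : ℝ), stdNormalPDF v = stdNormalCDF 0 := by
    have h := integral_comp_neg_Ioi (0 : ℝ) stdNormalPDF
    simpa [stdNormalPDF_neg, stdNormalCDF] using h
  have h2 := intervalIntegral.integral_Iic_add_Ioi (b := (0 : ℝ))
    integrable_stdNormalPDF.integrableOn integrable_stdNormalPDF.integrableOn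
  rw [h1, integral_stdNormalPDF] at h2
  change stdNormalCDF 0 + stdNormalCDF 0 = 1 at h2
  linarith

lemma stdNormalPDF_le_exp (u : ℝ) :
    stdNormalPDF u ≤ Real.exp (1 / 2) / Real.sqrt (2 * Real.pi) * Real.exp u := by
  rw [div_mul_eq_mul_div, ← Real.exp_add, stdNormalPDF]
  gcongr
  nlinarith [sq_nonneg (u + 1)]

lemma stdNormalCDF_le_exp (u : ℝ) :
    stdNormalCDF u ≤ Real.exp (1 / 2) / Real.sqrt (2 * Real.pi) * Real.exp u := by
  rw [← integral_exp_Iic u, ← integral_const_mul]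
  exact setIntegral_mono integrable_stdNormalPDF.integrableOn
    ((integrableOn_exp_Iic u).const_mul _) stdNormalPDF_le_exp

lemma tendsto_pow_mul_of_le_exp {f : ℝ → ℝ} {C : ℝ} (h0 : ∀ u, 0 ≤ f u)
    (h : ∀ u, f u ≤ C * Real.exp (-u)) (n : ℕ) :
    Tendsto (fun u => u ^ n * f u) atTop (𝓝 0) := by
  have h1 := (Real.tendsto_pow_mul_exp_neg_atTop_nhds_zero n).const_mul C
  rw [mul_zero] at h1
  refine squeeze_zero' ?_ ?_ h1
  · filter_upwards [eventually_ge_atTop 0] with u hu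
    exact mul_nonneg (pow_nonneg hu n) (h0 u)
  · filter_upwards [eventually_ge_atTop 0] with u hu
    calc u ^ n * f u ≤ u ^ n * (C * Real.exp (-u)) :=
          mul_le_mul_of_nonneg_left (h u) (pow_nonneg hu n)
      _ = _ := by ring

lemma tendsto_pow_mul_stdNormalPDF (n : ℕ) :
    Tendsto (fun u => u ^ n * stdNormalPDF u) atTop (𝓝 0) :=
  tendsto_pow_mul_of_le_exp stdNormalPDF_nonneg
    (fun u => by simpa [stdNormalPDF_neg] using stdNormalPDF_le_exp (-u)) n

lemma tendsto_pow_mul_stdNormalCDF_neg (n : ℕ) :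
    Tendsto (fun u => u ^ n * stdNormalCDF (-u)) atTop (𝓝 0) :=
  tendsto_pow_mul_of_le_exp (fun u => stdNormalCDF_nonneg (-u))
    (fun u => stdNormalCDF_le_exp (-u)) n

lemma tendsto_affine_atTop {p : ℝ} (hp : 0 < p) (q : ℝ) :
    Tendsto (fun x => p * x + q) atTop atTop :=
  tendsto_atTop_add_const_right _ _ (tendsto_id.const_mul_atTop hp)

lemma hasDerivAt_affine (p q x : ℝ) : HasDerivAt (fun x => p * x + q) p x := by
  simpa using ((hasDerivAt_id' x).const_mul p).add_const q

lemma hasDerivAt_stdNormalPDF_affine (p q x : ℝ) :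
    HasDerivAt (fun x => stdNormalPDF (p * x + q))
      (-(p * x + q) * stdNormalPDF (p * x + q) * p) x :=
  HasDerivAt.comp x (h₂ := stdNormalPDF) (hasDerivAt_stdNormalPDF (p * x + q))
    (hasDerivAt_affine p q x)

lemma hasDerivAt_stdNormalCDF_neg_affine (p q x : ℝ) :
    HasDerivAt (fun x => stdNormalCDF (-(p * x + q)))
      (-(p * stdNormalPDF (p * x + q))) x := by
  refine (HasDerivAt.comp x (h₂ := stdNormalCDF) (hasDerivAt_stdNormalCDF (-(p * x + q)))
    (hasDerivAt_affine p q x).fun_neg).congr_deriv ?_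
  rw [stdNormalPDF_neg]; ring

/-- Fundamental theorem of calculus on `(0, ∞)` for a nonnegative derivative. -/
lemma integrableOn_and_integral_of_hasDerivAt {f F : ℝ → ℝ} {v : ℝ}
    (hF : ∀ x, HasDerivAt F (f x) x) (hf : ∀ x, 0 < x → 0 ≤ f x)
    (hlim : Tendsto F atTop (𝓝 0)) (hv : F 0 = -v) :
    IntegrableOn f (Set.Ioi 0) ∧ ∫ x in Set.Ioi (0 : ℝ), f x = v := by
  refine ⟨integrableOn_Ioi_deriv_of_nonneg' (fun x _ => hF x) (fun x hx => hf x hx) hlim, ?_⟩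
  rw [integral_Ioi_of_hasDerivAt_of_nonneg' (fun x _ => hF x) (fun x hx => hf x hx) hlim, hv]
  ring

lemma hasDerivAt_stdNormalPDF_moment_one {p : ℝ} (hp : 0 < p) (q x : ℝ) :
    HasDerivAt (fun x => (q * stdNormalCDF (-(p * x + q)) - stdNormalPDF (p * x + q)) / p ^ 2)
      (x * stdNormalPDF (p * x + q)) x := by
  refine ((((hasDerivAt_stdNormalCDF_neg_affine p q x).const_mul q).fun_sub
    (hasDerivAt_stdNormalPDF_affine p q x)).div_const (p ^ 2)).congr_deriv ?_
  field_simp; ring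

lemma tendsto_stdNormalPDF_affine {p : ℝ} (hp : 0 < p) (q : ℝ) :
    Tendsto (fun x => stdNormalPDF (p * x + q)) atTop (𝓝 0) := by
  simpa [Function.comp_def] using
    (tendsto_pow_mul_stdNormalPDF 0).comp (tendsto_affine_atTop hp q)

lemma tendsto_stdNormalCDF_neg_affine {p : ℝ} (hp : 0 < p) (q : ℝ) :
    Tendsto (fun x => stdNormalCDF (-(p * x + q))) atTop (𝓝 0) := by
  simpa [Function.comp_def] using
    (tendsto_pow_mul_stdNormalCDF_neg 0).comp (tendsto_affine_atTop hp q)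

lemma integral_mul_stdNormalPDF_affine {p : ℝ} (hp : 0 < p) (q : ℝ) :
    IntegrableOn (fun x => x * stdNormalPDF (p * x + q)) (Set.Ioi 0) ∧
    ∫ x in Set.Ioi (0 : ℝ), x * stdNormalPDF (p * x + q) =
      (stdNormalPDF q - q * stdNormalCDF (-q)) / p ^ 2 := by
  refine integrableOn_and_integral_of_hasDerivAt (hasDerivAt_stdNormalPDF_moment_one hp q)
    (fun x hx => mul_nonneg hx.le (stdNormalPDF_nonneg _)) ?_ ?_
  · simpa only [mul_zero, sub_zero, add_zero, neg_zero, zero_div, pow_zero, one_mul] using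
      (((tendsto_stdNormalCDF_neg_affine hp q).const_mul q).sub
      (tendsto_stdNormalPDF_affine hp q)).div_const (p ^ 2)
  · simp only [mul_zero, zero_add]; ring

lemma integral_sq_mul_stdNormalPDF_affine {p : ℝ} (hp : 0 < p) (q : ℝ) :
    IntegrableOn (fun x => x ^ 2 * stdNormalPDF (p * x + q)) (Set.Ioi 0) ∧
    ∫ x in Set.Ioi (0 : ℝ), x ^ 2 * stdNormalPDF (p * x + q) =
      ((1 + q ^ 2) * stdNormalCDF (-q) - q * stdNormalPDF q) / p ^ 3 := by
  refine integrableOn_and_integral_of_hasDerivAt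
    (F := fun x => (2 * q * stdNormalPDF (p * x + q)
      - (p * x + q) * stdNormalPDF (p * x + q)
      - (1 + q ^ 2) * stdNormalCDF (-(p * x + q))) / p ^ 3) (fun x => ?_)
    (fun x hx => mul_nonneg (sq_nonneg x) (stdNormalPDF_nonneg _)) ?_ ?_
  · refine (((((hasDerivAt_stdNormalPDF_affine p q x).const_mul (2 * q)).fun_sub
      ((hasDerivAt_affine p q x).fun_mul (hasDerivAt_stdNormalPDF_affine p q x))).fun_sub
      ((hasDerivAt_stdNormalCDF_neg_affine p q x).const_mul (1 + q ^ 2))).div_const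
      (p ^ 3)).congr_deriv ?_
    field_simp; ring
  · have h := (tendsto_pow_mul_stdNormalPDF 1).comp (tendsto_affine_atTop hp q)
    simp only [pow_one, Function.comp_def] at h
    simpa only [mul_zero, sub_zero, add_zero, neg_zero, zero_div, pow_zero, one_mul] using
      ((((tendsto_stdNormalPDF_affine hp q).const_mul (2 * q)).sub h).sub
      ((tendsto_stdNormalCDF_neg_affine hp q).const_mul (1 + q ^ 2))).div_const (p ^ 3)
  · simp only [mul_zero, zero_add]; ring

lemma tendsto_mul_stdNormalCDF_of_tendsto_zero {f g : ℝ → ℝ} (hf : Tendsto f atTop (𝓝 0)) :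
    Tendsto (fun x => f x * stdNormalCDF (g x)) atTop (𝓝 0) := by
  refine squeeze_zero_norm (fun x => ?_) (tendsto_zero_iff_norm_tendsto_zero.mp hf)
  rw [norm_mul, Real.norm_of_nonneg (stdNormalCDF_nonneg _)]
  exact mul_le_of_le_one_right (norm_nonneg _) (stdNormalCDF_le_one _)

lemma tendsto_affine_mul_exp_neg {k : ℝ} (hk : 0 < k) (a b : ℝ) :
    Tendsto (fun x => (a * x + b) * Real.exp (-(k * x))) atTop (𝓝 0) := by
  have hlin : Tendsto (fun x : ℝ => k * x) atTop atTop := tendsto_id.const_mul_atTop hk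
  have h0 := ((Real.tendsto_pow_mul_exp_neg_atTop_nhds_zero 0).comp hlin).const_mul b
  have h1 := ((Real.tendsto_pow_mul_exp_neg_atTop_nhds_zero 1).comp hlin).const_mul (a / k)
  have h := h1.add h0
  simp only [mul_zero, add_zero] at h
  refine h.congr fun x => ?_
  simp only [Function.comp_apply]
  field_simp

/-- The hypothesis `h` expresses completion of the square in the exponent. -/
lemma integral_mul_exp_mul_stdNormalCDF_affine {p q r k m : ℝ} (hp : 0 < p) (hk : 0 < k)
    (h : ∀ x, Real.exp (-(k * x) - m) * stdNormalPDF (p * x + r) = stdNormalPDF (p * x + q)) :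
    IntegrableOn (fun x => x * (Real.exp (-(k * x) - m) * stdNormalCDF (-(p * x + r))))
      (Set.Ioi 0) ∧
    ∫ x in Set.Ioi (0 : ℝ), x * (Real.exp (-(k * x) - m) * stdNormalCDF (-(p * x + r))) =
      Real.exp (-m) * stdNormalCDF (-r) / k ^ 2
        - (stdNormalPDF q - q * stdNormalCDF (-q)) / (k * p) - stdNormalCDF (-q) / k ^ 2 := by
  refine integrableOn_and_integral_of_hasDerivAt
    (F := fun x => -((1 / k * x + 1 / k ^ 2) * Real.exp (-(k * x) - m)
        * stdNormalCDF (-(p * x + r)))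
      - p / k * ((q * stdNormalCDF (-(p * x + q)) - stdNormalPDF (p * x + q)) / p ^ 2)
      + 1 / k ^ 2 * stdNormalCDF (-(p * x + q))) (fun x => ?_)
    (fun x hx => mul_nonneg hx.le (mul_nonneg (Real.exp_nonneg _) (stdNormalCDF_nonneg _))) ?_ ?_
  · have he : HasDerivAt (fun x => Real.exp (-(k * x) - m))
        (Real.exp (-(k * x) - m) * (-k)) x := by
      refine HasDerivAt.exp ?_
      simpa using (((hasDerivAt_id' x).const_mul k).fun_neg).sub_const m
    have hd := ((((hasDerivAt_affine (1 / k) (1 / k ^ 2) x).fun_mul he).fun_mul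
      (hasDerivAt_stdNormalCDF_neg_affine p r x)).fun_neg.fun_sub
      ((hasDerivAt_stdNormalPDF_moment_one hp q x).const_mul (p / k))).fun_add
      ((hasDerivAt_stdNormalCDF_neg_affine p q x).const_mul (1 / k ^ 2))
    refine hd.congr_deriv ?_
    rw [← h x]
    field_simp
    ring
  · have h1 : Tendsto (fun x => (1 / k * x + 1 / k ^ 2) * Real.exp (-(k * x) - m))
        atTop (𝓝 0) := by
      have := (tendsto_affine_mul_exp_neg hk (1 / k) (1 / k ^ 2)).mul_const (Real.exp (-m))
      rw [zero_mul] at this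
      refine this.congr fun x => ?_
      rw [mul_assoc, ← Real.exp_add, sub_eq_add_neg]
    have h2 := tendsto_mul_stdNormalCDF_of_tendsto_zero (g := fun x => -(p * x + r)) h1
    have hC := tendsto_stdNormalCDF_neg_affine hp q
    have h3 := (h2.neg.sub ((((hC.const_mul q).sub
      (tendsto_stdNormalPDF_affine hp q)).div_const (p ^ 2)).const_mul (p / k))).add
      (hC.const_mul (1 / k ^ 2))
    simp only [mul_zero, sub_zero, add_zero, neg_zero, zero_div] at h3
    exact h3
  · simp only [mul_zero, zero_add, neg_zero, zero_sub]
    field_simp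
    ring

lemma hasDerivAt_stdNormalPDF_mul (a x : ℝ) :
    HasDerivAt (fun x => stdNormalPDF (a * x)) (-(a ^ 2 * x) * stdNormalPDF (a * x)) x := by
  have h := hasDerivAt_stdNormalPDF_affine a 0 x
  simp only [add_zero] at h
  exact h.congr_deriv (by ring)

lemma hasDerivAt_stdNormalCDF_neg_mul (a x : ℝ) :
    HasDerivAt (fun x => stdNormalCDF (-(a * x))) (-(a * stdNormalPDF (a * x))) x := by
  simpa using hasDerivAt_stdNormalCDF_neg_affine a 0 x

lemma tendsto_pow_mul_stdNormalPDF_mul {a : ℝ} (ha : 0 < a) (n : ℕ) :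
    Tendsto (fun x => x ^ n * stdNormalPDF (a * x)) atTop (𝓝 0) := by
  have h := ((tendsto_pow_mul_stdNormalPDF n).comp
    (tendsto_id.const_mul_atTop ha)).const_mul ((a ^ n)⁻¹)
  rw [mul_zero] at h
  refine h.congr fun x => ?_
  simp only [Function.comp_apply, id, mul_pow]
  field_simp

lemma tendsto_pow_mul_stdNormalCDF_neg_mul {a : ℝ} (ha : 0 < a) (n : ℕ) :
    Tendsto (fun x => x ^ n * stdNormalCDF (-(a * x))) atTop (𝓝 0) := by
  have h := ((tendsto_pow_mul_stdNormalCDF_neg n).comp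
    (tendsto_id.const_mul_atTop ha)).const_mul ((a ^ n)⁻¹)
  rw [mul_zero] at h
  refine h.congr fun x => ?_
  simp only [Function.comp_apply, id, mul_pow]
  field_simp

lemma integral_pow_four_mul_stdNormalPDF {a : ℝ} (ha : 0 < a) :
    IntegrableOn (fun w => w ^ 4 * stdNormalPDF (a * w)) (Set.Ioi 0) ∧
    ∫ w in Set.Ioi (0 : ℝ), w ^ 4 * stdNormalPDF (a * w) = 3 / (2 * a ^ 5) := by
  refine integrableOn_and_integral_of_hasDerivAt
    (F := fun w => -(1 / a ^ 2) * (w ^ 3 * stdNormalPDF (a * w))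
      - 3 / a ^ 4 * (w ^ 1 * stdNormalPDF (a * w))
      - 3 / a ^ 5 * stdNormalCDF (-(a * w))) (fun w => ?_)
    (fun w hw => mul_nonneg (by positivity) (stdNormalPDF_nonneg _)) ?_ ?_
  · have hP := hasDerivAt_stdNormalPDF_mul a w
    refine (((((hasDerivAt_pow 3 w).fun_mul hP).const_mul (-(1 / a ^ 2))).fun_sub
      (((hasDerivAt_pow 1 w).fun_mul hP).const_mul (3 / a ^ 4))).fun_sub
      ((hasDerivAt_stdNormalCDF_neg_mul a w).const_mul (3 / a ^ 5))).congr_deriv ?_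
    field_simp
    norm_num
    ring
  · simpa only [mul_zero, sub_zero, add_zero, neg_zero, zero_div, pow_zero, one_mul] using
      (((tendsto_pow_mul_stdNormalPDF_mul ha 3).const_mul (-(1 / a ^ 2))).sub
      ((tendsto_pow_mul_stdNormalPDF_mul ha 1).const_mul (3 / a ^ 4))).sub
      ((tendsto_pow_mul_stdNormalCDF_neg_mul ha 0).const_mul (3 / a ^ 5))
  · simp only [mul_zero, neg_zero, stdNormalCDF_zero]
    field_simp
    norm_num

lemma integral_pow_three_mul_stdNormalCDF {a : ℝ} (ha : 0 < a) :
    IntegrableOn (fun w => w ^ 3 * stdNormalCDF (-(a * w))) (Set.Ioi 0) ∧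
    ∫ w in Set.Ioi (0 : ℝ), w ^ 3 * stdNormalCDF (-(a * w)) = 3 / (8 * a ^ 4) := by
  refine integrableOn_and_integral_of_hasDerivAt
    (F := fun w => 1 / 4 * (w ^ 4 * stdNormalCDF (-(a * w)))
      - 1 / (4 * a) * (w ^ 3 * stdNormalPDF (a * w))
      - 3 / (4 * a ^ 3) * (w ^ 1 * stdNormalPDF (a * w))
      - 3 / (4 * a ^ 4) * stdNormalCDF (-(a * w))) (fun w => ?_)
    (fun w hw => mul_nonneg (by positivity) (stdNormalCDF_nonneg _)) ?_ ?_
  · have hP := hasDerivAt_stdNormalPDF_mul a w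
    have hC := hasDerivAt_stdNormalCDF_neg_mul a w
    refine ((((((hasDerivAt_pow 4 w).fun_mul hC).const_mul (1 / 4)).fun_sub
      (((hasDerivAt_pow 3 w).fun_mul hP).const_mul (1 / (4 * a)))).fun_sub
      (((hasDerivAt_pow 1 w).fun_mul hP).const_mul (3 / (4 * a ^ 3)))).fun_sub
      (hC.const_mul (3 / (4 * a ^ 4)))).congr_deriv ?_
    field_simp
    norm_num
    ring
  · simpa only [mul_zero, sub_zero, add_zero, neg_zero, zero_div, pow_zero, one_mul] using
      ((((tendsto_pow_mul_stdNormalCDF_neg_mul ha 4).const_mul (1 / 4)).sub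
      ((tendsto_pow_mul_stdNormalPDF_mul ha 3).const_mul (1 / (4 * a)))).sub
      ((tendsto_pow_mul_stdNormalPDF_mul ha 1).const_mul (3 / (4 * a ^ 3)))).sub
      ((tendsto_pow_mul_stdNormalCDF_neg_mul ha 0).const_mul (3 / (4 * a ^ 4)))
  · simp only [mul_zero, neg_zero, stdNormalCDF_zero]
    field_simp
    norm_num

lemma integral_pow_five_mul_stdNormalCDF {a : ℝ} (ha : 0 < a) :
    IntegrableOn (fun w => w ^ 5 * stdNormalCDF (-(a * w))) (Set.Ioi 0) ∧
    ∫ w in Set.Ioi (0 : ℝ), w ^ 5 * stdNormalCDF (-(a * w)) = 5 / (4 * a ^ 6) := by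
  refine integrableOn_and_integral_of_hasDerivAt
    (F := fun w => 1 / 6 * (w ^ 6 * stdNormalCDF (-(a * w)))
      - 1 / (6 * a) * (w ^ 5 * stdNormalPDF (a * w))
      - 5 / (6 * a ^ 3) * (w ^ 3 * stdNormalPDF (a * w))
      - 5 / (2 * a ^ 5) * (w ^ 1 * stdNormalPDF (a * w))
      - 5 / (2 * a ^ 6) * stdNormalCDF (-(a * w))) (fun w => ?_)
    (fun w hw => mul_nonneg (by positivity) (stdNormalCDF_nonneg _)) ?_ ?_
  · have hP := hasDerivAt_stdNormalPDF_mul a w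
    have hC := hasDerivAt_stdNormalCDF_neg_mul a w
    refine (((((((hasDerivAt_pow 6 w).fun_mul hC).const_mul (1 / 6)).fun_sub
      (((hasDerivAt_pow 5 w).fun_mul hP).const_mul (1 / (6 * a)))).fun_sub
      (((hasDerivAt_pow 3 w).fun_mul hP).const_mul (5 / (6 * a ^ 3)))).fun_sub
      (((hasDerivAt_pow 1 w).fun_mul hP).const_mul (5 / (2 * a ^ 5)))).fun_sub
      (hC.const_mul (5 / (2 * a ^ 6)))).congr_deriv ?_
    field_simp
    norm_num
    ring
  · simpa only [mul_zero, sub_zero, add_zero, neg_zero, zero_div, pow_zero, one_mul] using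
      (((((tendsto_pow_mul_stdNormalCDF_neg_mul ha 6).const_mul (1 / 6)).sub
      ((tendsto_pow_mul_stdNormalPDF_mul ha 5).const_mul (1 / (6 * a)))).sub
      ((tendsto_pow_mul_stdNormalPDF_mul ha 3).const_mul (5 / (6 * a ^ 3)))).sub
      ((tendsto_pow_mul_stdNormalPDF_mul ha 1).const_mul (5 / (2 * a ^ 5)))).sub
      ((tendsto_pow_mul_stdNormalCDF_neg_mul ha 0).const_mul (5 / (2 * a ^ 6)))
  · simp only [mul_zero, neg_zero, stdNormalCDF_zero]
    field_simp
    norm_num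

lemma integral_pow_three_mul_exp_mul_stdNormalCDF {a b m : ℝ} (ha : 0 < a) (hm : 0 < m)
    (h : ∀ w, Real.exp (-(m * w ^ 2)) * stdNormalPDF (b * w) = stdNormalPDF (a * w)) :
    IntegrableOn (fun w => w ^ 3 * (Real.exp (-(m * w ^ 2)) * stdNormalCDF (-(b * w))))
      (Set.Ioi 0) ∧
    ∫ w in Set.Ioi (0 : ℝ), w ^ 3 * (Real.exp (-(m * w ^ 2)) * stdNormalCDF (-(b * w))) =
      1 / (4 * m ^ 2) - b / (4 * a ^ 3 * m) - b / (4 * a * m ^ 2) := by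
  refine integrableOn_and_integral_of_hasDerivAt
    (F := fun w => -((1 / (2 * m) * w ^ 2 + 1 / (2 * m ^ 2)) * Real.exp (-(m * w ^ 2))
        * stdNormalCDF (-(b * w)))
      + b / (2 * m * a ^ 2) * (w ^ 1 * stdNormalPDF (a * w))
      + (b / (2 * m * a ^ 3) + b / (2 * a * m ^ 2)) * stdNormalCDF (-(a * w))) (fun w => ?_)
    (fun w hw => mul_nonneg (by positivity)
      (mul_nonneg (Real.exp_nonneg _) (stdNormalCDF_nonneg _))) ?_ ?_
  · have he : HasDerivAt (fun w => Real.exp (-(m * w ^ 2)))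
        (Real.exp (-(m * w ^ 2)) * (-(m * (2 * w)))) w := by
      refine HasDerivAt.exp ?_
      simpa using ((hasDerivAt_pow 2 w).const_mul m).fun_neg
    have hq : HasDerivAt (fun w : ℝ => 1 / (2 * m) * w ^ 2 + 1 / (2 * m ^ 2))
        (1 / (2 * m) * (2 * w)) w := by
      simpa using ((hasDerivAt_pow 2 w).const_mul (1 / (2 * m))).add_const (1 / (2 * m ^ 2))
    refine ((((hq.fun_mul he).fun_mul (hasDerivAt_stdNormalCDF_neg_mul b w)).fun_neg.fun_add
      (((hasDerivAt_pow 1 w).fun_mul (hasDerivAt_stdNormalPDF_mul a w)).const_mul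
        (b / (2 * m * a ^ 2)))).fun_add
      ((hasDerivAt_stdNormalCDF_neg_mul a w).const_mul
        (b / (2 * m * a ^ 3) + b / (2 * a * m ^ 2)))).congr_deriv ?_
    rw [← h w]
    field_simp
    norm_num
    ring
  · have h1 : Tendsto (fun w : ℝ => (1 / (2 * m) * w ^ 2 + 1 / (2 * m ^ 2))
        * Real.exp (-(m * w ^ 2))) atTop (𝓝 0) :=
      (tendsto_affine_mul_exp_neg hm (1 / (2 * m)) (1 / (2 * m ^ 2))).comp
        (tendsto_pow_atTop two_ne_zero)
    have h2 := tendsto_mul_stdNormalCDF_of_tendsto_zero (g := fun w => -(b * w)) h1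
    have h3 := (h2.neg.add ((tendsto_pow_mul_stdNormalPDF_mul ha 1).const_mul
      (b / (2 * m * a ^ 2)))).add ((tendsto_pow_mul_stdNormalCDF_neg_mul ha 0).const_mul
      (b / (2 * m * a ^ 3) + b / (2 * a * m ^ 2)))
    simp only [mul_zero, add_zero, neg_zero, pow_zero, one_mul] at h3
    exact h3
  · simp only [mul_zero, neg_zero, stdNormalCDF_zero]
    field_simp
    norm_num
    ring

lemma exp_mul_stdNormalPDF {s u v : ℝ} (h : s = (u ^ 2 - v ^ 2) / 2) :
    Real.exp (-s) * stdNormalPDF v = stdNormalPDF u := by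
  rw [stdNormalPDF, stdNormalPDF, mul_div_assoc', ← Real.exp_add, h]
  ring_nf

/-- The integral over `x` at `z = w ^ 2`, with `ν₁ = ν₂ + d ^ 2`. -/
lemma integral_inner_sq {σ ν₂ d w : ℝ} (hσ : 0 < σ) (hd : 0 < d) (hw : 0 < w) :
    ∫ x in Set.Ioi (0 : ℝ), w ^ 2 * x *
        (stdNormalPDF ((x * d ^ 2 + (ν₂ + d ^ 2) * w ^ 2) / (σ * (d * w))) *
          (2 * ν₂ * d * (x + 2 * w ^ 2)) / (σ ^ 3 * w ^ 3)
        + 4 * ν₂ * (2 * d ^ 2 - (ν₂ + d ^ 2)) / σ ^ 4 *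
            Real.exp ((-2 * d ^ 2 * x - 2 * ν₂ * w ^ 2) / σ ^ 2) *
            stdNormalCDF ((-x * d ^ 2 - (2 * ν₂ - (ν₂ + d ^ 2)) * w ^ 2) / (σ * (d * w))))
      = w ^ 2 * (2 * ν₂ * d / (σ ^ 3 * w ^ 3)) * (
          ((1 + ((ν₂ + d ^ 2) / (σ * d) * w) ^ 2) * stdNormalCDF (-((ν₂ + d ^ 2) / (σ * d) * w))
          - (ν₂ + d ^ 2) / (σ * d) * w * stdNormalPDF ((ν₂ + d ^ 2) / (σ * d) * w))
            / (d / (σ * w)) ^ 3)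
        + w ^ 2 * (2 * ν₂ * d / (σ ^ 3 * w ^ 3)) * (2 * w ^ 2) * (
          (stdNormalPDF ((ν₂ + d ^ 2) / (σ * d) * w) - (ν₂ + d ^ 2) / (σ * d) * w
          * stdNormalCDF (-((ν₂ + d ^ 2) / (σ * d) * w))) / (d / (σ * w)) ^ 2)
        + w ^ 2 * (4 * ν₂ * (d ^ 2 - ν₂) / σ ^ 4) * (
          Real.exp (-(2 * ν₂ / σ ^ 2 * w ^ 2))
            * stdNormalCDF (-((ν₂ - d ^ 2) / (σ * d) * w)) / (2 * d ^ 2 / σ ^ 2) ^ 2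
          - (stdNormalPDF ((ν₂ + d ^ 2) / (σ * d) * w) - (ν₂ + d ^ 2) / (σ * d) * w
            * stdNormalCDF (-((ν₂ + d ^ 2) / (σ * d) * w))) / (2 * d ^ 2 / σ ^ 2 * (d / (σ * w)))
          - stdNormalCDF (-((ν₂ + d ^ 2) / (σ * d) * w)) / (2 * d ^ 2 / σ ^ 2) ^ 2) := by
  set a := (ν₂ + d ^ 2) / (σ * d) with ha
  set b := (ν₂ - d ^ 2) / (σ * d) with hb
  set p := d / (σ * w) with hp
  have hp0 : 0 < p := by positivity
  have hk0 : 0 < 2 * d ^ 2 / σ ^ 2 := by positivity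
  obtain ⟨i2, e2⟩ := integral_sq_mul_stdNormalPDF_affine hp0 (a * w)
  obtain ⟨i1, e1⟩ := integral_mul_stdNormalPDF_affine hp0 (a * w)
  obtain ⟨i3, e3⟩ := integral_mul_exp_mul_stdNormalCDF_affine (p := p) (q := a * w) (r := b * w)
    (k := 2 * d ^ 2 / σ ^ 2) (m := 2 * ν₂ / σ ^ 2 * w ^ 2) hp0 hk0 (fun x => by
      rw [← exp_mul_stdNormalPDF (s := 2 * d ^ 2 / σ ^ 2 * x + 2 * ν₂ / σ ^ 2 * w ^ 2)
        (u := p * x + a * w) (v := p * x + b * w), neg_add, sub_eq_add_neg]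
      rw [ha, hb, hp]
      field_simp
      ring)
  rw [← e2, ← e1, ← e3, ← integral_const_mul, ← integral_const_mul, ← integral_const_mul,
    ← integral_add (i2.const_mul _) (i1.const_mul _),
    ← integral_add ((i2.const_mul _).fun_add (i1.const_mul _)) (i3.const_mul _)]
  refine integral_congr_ae (Eventually.of_forall fun x => ?_)
  have hA : (x * d ^ 2 + (ν₂ + d ^ 2) * w ^ 2) / (σ * (d * w)) = p * x + a * w := by
    rw [ha, hp]; field_simp
  have hB : (-x * d ^ 2 - (2 * ν₂ - (ν₂ + d ^ 2)) * w ^ 2) / (σ * (d * w))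
      = -(p * x + b * w) := by
    rw [hb, hp]; field_simp; ring
  have hE : (-2 * d ^ 2 * x - 2 * ν₂ * w ^ 2) / σ ^ 2
      = -(2 * d ^ 2 / σ ^ 2 * x) - 2 * ν₂ / σ ^ 2 * w ^ 2 := by
    field_simp
  simp only [hA, hB, hE]
  ring

/-- **Moment computation for the joint density.** For `0 < ν₂ < ν₁`, `δ = ν₁ − ν₂`
and the density `g` of `(M_*^{ν₁}, M_*^{ν₂} − M_*^{ν₁})`,
`∫₀^∞ ∫₀^∞ z x g(x,z) dx dz = σ⁴(ν₁² − ν₂²)/(4ν₁³ν₂)`. -/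
theorem stmt_16 (σ ν₁ ν₂ : ℝ) (hσ : 0 < σ) (hν₂ : 0 < ν₂) (h₂₁ : ν₂ < ν₁) :
    (∫ z in Set.Ioi (0 : ℝ), ∫ x in Set.Ioi (0 : ℝ), z * x *
        (stdNormalPDF ((x * (ν₁ - ν₂) + ν₁ * z) /
            (σ * Real.sqrt ((ν₁ - ν₂) * z))) *
          (2 * ν₂ * Real.sqrt (ν₁ - ν₂) * (x + 2 * z)) /
            (σ ^ 3 * z ^ ((3 : ℝ) / 2))
        + 4 * ν₂ * (2 * (ν₁ - ν₂) - ν₁) / σ ^ 4 *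
            Real.exp ((-2 * (ν₁ - ν₂) * x - 2 * ν₂ * z) / σ ^ 2) *
            stdNormalCDF ((-x * (ν₁ - ν₂) - (2 * ν₂ - ν₁) * z) /
              (σ * Real.sqrt ((ν₁ - ν₂) * z)))))
      = σ ^ 4 * (ν₁ ^ 2 - ν₂ ^ 2) / (4 * ν₁ ^ 3 * ν₂) := by
  obtain ⟨d, hd, hν⟩ : ∃ d : ℝ, 0 < d ∧ ν₁ = ν₂ + d ^ 2 :=
    ⟨Real.sqrt (ν₁ - ν₂), Real.sqrt_pos.mpr (sub_pos.mpr h₂₁), by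
      rw [Real.sq_sqrt (sub_nonneg.mpr h₂₁.le)]; ring⟩
  subst hν
  set a := (ν₂ + d ^ 2) / (σ * d) with ha
  set b := (ν₂ - d ^ 2) / (σ * d) with hb
  set m := 2 * ν₂ / σ ^ 2 with hm
  have ha0 : 0 < a := by positivity
  have hm0 : 0 < m := by positivity
  obtain ⟨i1, e1⟩ := integral_pow_four_mul_stdNormalPDF ha0
  obtain ⟨i2, e2⟩ := integral_pow_three_mul_stdNormalCDF ha0
  obtain ⟨i3, e3⟩ := integral_pow_five_mul_stdNormalCDF ha0
  obtain ⟨i4, e4⟩ := integral_pow_three_mul_exp_mul_stdNormalCDF (b := b) ha0 hm0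
    (fun w => exp_mul_stdNormalPDF (by rw [ha, hb, hm]; field_simp; ring))
  rw [← integral_comp_rpow_Ioi_of_pos two_pos]
  have key : ∀ c₁ c₂ c₃ c₄ : ℝ, ∫ w in Set.Ioi (0 : ℝ), (c₁ * (w ^ 4 * stdNormalPDF (a * w))
      + c₂ * (w ^ 3 * stdNormalCDF (-(a * w))) + c₃ * (w ^ 5 * stdNormalCDF (-(a * w)))
      + c₄ * (w ^ 3 * (Real.exp (-(m * w ^ 2)) * stdNormalCDF (-(b * w)))))
      = c₁ * (3 / (2 * a ^ 5)) + c₂ * (3 / (8 * a ^ 4)) + c₃ * (5 / (4 * a ^ 6))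
        + c₄ * (1 / (4 * m ^ 2) - b / (4 * a ^ 3 * m) - b / (4 * a * m ^ 2)) := by
    intro c₁ c₂ c₃ c₄
    rw [integral_add (((i1.const_mul c₁).fun_add (i2.const_mul c₂)).fun_add (i3.const_mul c₃))
      (i4.const_mul c₄), integral_add ((i1.const_mul c₁).fun_add (i2.const_mul c₂))
      (i3.const_mul c₃), integral_add (i1.const_mul c₁) (i2.const_mul c₂)]
    simp only [integral_const_mul, e1, e2, e3, e4]
  have hval := key
    (2 * (2 * ν₂ / d ^ 2 * -a + 4 * ν₂ / (σ * d)
      - 4 * ν₂ * (d ^ 2 - ν₂) / σ ^ 4 * (σ ^ 3 / (2 * d ^ 3))))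
    (2 * (2 * ν₂ / d ^ 2 - 4 * ν₂ * (d ^ 2 - ν₂) / (4 * d ^ 4)))
    (2 * (2 * ν₂ / d ^ 2 * a ^ 2 - 4 * ν₂ / (σ * d) * a
      + 4 * ν₂ * (d ^ 2 - ν₂) / σ ^ 4 * (σ ^ 3 / (2 * d ^ 3)) * a))
    (2 * (4 * ν₂ * (d ^ 2 - ν₂) / (4 * d ^ 4)))
  refine (setIntegral_congr_fun measurableSet_Ioi fun w (hw : 0 < w) => ?_).trans
    (hval.trans ?_)
  · have hw2 : w ^ (2 : ℝ) = w ^ 2 := Real.rpow_two w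
    have hw3 : (w ^ 2) ^ ((3 : ℝ) / 2) = w ^ 3 := by
      rw [← Real.rpow_natCast_mul hw.le, ← Real.rpow_natCast]; norm_num
    have hδ : ν₂ + d ^ 2 - ν₂ = d ^ 2 := by ring
    have hs : Real.sqrt (d ^ 2 * w ^ 2) = d * w := by
      rw [← mul_pow, Real.sqrt_sq (by positivity)]
    have hw1 : w ^ ((2 : ℝ) - 1) = w := by norm_num
    simp only [hw2, hw3, hδ, hs, hw1, Real.sqrt_sq hd.le, smul_eq_mul]
    rw [integral_inner_sq hσ hd hw, ← ha, ← hb, ← hm]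
    clear_value a b m
    field_simp
    ring
  · rw [ha, hb, hm]
    field_simp
    ring
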